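/- arXiv:math/0405523 — 2 statements merged into one kernel-verified Lean document; each statement's English description precedes it below -/
import Mathlib

section
/- Let A be a commutative noetherian ring, let C be a semi-dualizing module for A, and set R = A ⋉ C. Then A and C, viewed as R-modules via the projection R → A, are finitely generated totally reflexive R-modules; explicitly: Ext^i_R(A, R) = 0 and Ext^i_R(C, R) = 0 for all i ≥ 1, and the biduality maps A → Hom_R(Hom_R(A, R), R) and C → Hom_R(Hom_R(C, R), R), sending an element x to evaluation at x, are isomorphisms. -/
open TrivSqZeroExt

/-- `Ext^i_R(M, N)` for modules `M`, `N` over a commutative ring `R`. -/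
noncomputable abbrev ExtGroup (R : Type) [CommRing R] (i : ℕ)
    (M : Type) [AddCommGroup M] [Module R M] (N : Type) [AddCommGroup N] [Module R N] : Type :=
  ((Ext R (ModuleCat R) i).obj (Opposite.op (ModuleCat.of R M))).obj (ModuleCat.of R N)

section
variable (A : Type) [CommRing A] (C : Type) [AddCommGroup C] [Module A C]

/-- Over a commutative ring every module is canonically a module over the opposite ring;
this provides the data needed for Mathlib's `TrivSqZeroExt A C` to be a commutative ring. -/
noncomputable instance : Module Aᵐᵒᵖ C :=
  Module.compHom C ((RingHom.id A).fromOpposite Commute.all)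

instance : IsCentralScalar A C := ⟨fun _ _ => rfl⟩

/-- `C` is a semi-dualizing module for `A`: it is finitely generated, the canonical map
`A → Hom_A(C,C)`, `a ↦ (a • ·)`, is bijective, and `Ext^i_A(C,C) = 0` for `i ≥ 1`. -/
def IsSemidualizing : Prop :=
  Module.Finite A C ∧ Function.Bijective (LinearMap.lsmul A C) ∧
    ∀ i : ℕ, 1 ≤ i → Subsingleton (ExtGroup A i C C)

/-- The `(A ⋉ C)`-module structure on `Hom_A(A ⋉ C, I)` coming from the `(A ⋉ C)`-action on
the first argument, `(r • f) x = f (r * x)`. -/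
noncomputable instance homModule (I : Type) [AddCommGroup I] [Module A I] :
    Module (TrivSqZeroExt A C) (TrivSqZeroExt A C →ₗ[A] I) where
  smul r f := f ∘ₗ LinearMap.mulLeft A r
  one_smul f := by ext x; simp [HSMul.hSMul, SMul.smul]
  mul_smul r s f := by ext x; simp [HSMul.hSMul, SMul.smul, mul_assoc, mul_left_comm]
  smul_zero r := by ext x; simp [HSMul.hSMul, SMul.smul]
  smul_add r f g := by ext x; simp [HSMul.hSMul, SMul.smul]
  add_smul r s f := by ext x; simp [HSMul.hSMul, SMul.smul, add_mul]
  zero_smul f := by ext x; simp [HSMul.hSMul, SMul.smul]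

/-- An `A`-module viewed as an `(A ⋉ C)`-module via the projection `A ⋉ C → A`. -/
noncomputable def moduleOfFst (M : Type) [AddCommGroup M] [Module A M] :
    Module (TrivSqZeroExt A C) M :=
  Module.compHom M (fstHom A A C).toRingHom

end

section

open CategoryTheory

/-- Mathlib's two definitions of `Ext` vanish simultaneously in positive degrees. -/
lemma subsingleton_extGroup_iff {R : Type} [CommRing R] {M : Type} [AddCommGroup M] [Module R M]
    {N : Type} [AddCommGroup N] [Module R N] (n : ℕ) :
    Subsingleton (ExtGroup R (n + 1) M N) ↔
      Subsingleton (Abelian.Ext (ModuleCat.of R M) (ModuleCat.of R N) (n + 1)) := by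
  let P := projectiveResolution (ModuleCat.of R M)
  have h₁ : Subsingleton (ExtGroup R (n + 1) M N) ↔
      ∀ f : P.complex.X (n + 1) ⟶ ModuleCat.of R N, P.complex.d (n + 2) (n + 1) ≫ f = 0 →
        ∃ g : P.complex.X n ⟶ ModuleCat.of R N, P.complex.d (n + 1) n ≫ g = f := by
    rw [← ModuleCat.isZero_iff_subsingleton, (P.isoExt (n + 1) (ModuleCat.of R N)).isZero_iff,
      ← HomologicalComplex.exactAt_iff_isZero_homology,
      HomologicalComplex.exactAt_iff' _ n (n + 1) (n + 2) (by simp) (by simp),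
      ShortComplex.moduleCat_exact_iff]
    exact Iff.rfl
  rw [h₁]
  constructor
  · refine fun h => subsingleton_of_forall_eq 0 fun x => ?_
    obtain ⟨f, hf, rfl⟩ := P.extMk_surjective x (n + 2) rfl
    exact (P.extMk_eq_zero_iff f (n + 2) rfl hf n rfl).2 (h f hf)
  · exact fun h f hf => (P.extMk_eq_zero_iff f (n + 2) rfl hf n rfl).1 (Subsingleton.elim _ _)

/-- In a short exact sequence, `Ext^n(X₁, Y) = 0` if `Ext^n(X₂, Y) = 0 = Ext^{n+1}(X₃, Y)`. -/
lemma CategoryTheory.ShortComplex.ShortExact.subsingleton_ext_X₁ {R : Type} [CommRing R]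
    {S : ShortComplex (ModuleCat.{0} R)} (hS : S.ShortExact) (Y : ModuleCat.{0} R) (n : ℕ)
    (h₂ : Subsingleton (Abelian.Ext S.X₂ Y n)) (h₃ : Subsingleton (Abelian.Ext S.X₃ Y (n + 1))) :
    Subsingleton (Abelian.Ext S.X₁ Y n) := by
  refine subsingleton_of_forall_eq 0 fun x => ?_
  obtain ⟨y, rfl⟩ := Abelian.Ext.contravariant_sequence_exact₁ hS Y x (add_comm 1 n)
    (Subsingleton.elim _ _)
  rw [Subsingleton.elim y 0, Abelian.Ext.comp_zero]

/-- If `Ext^1(X₃, Y) = 0`, every morphism `X₁ ⟶ Y` extends along `X₁ ⟶ X₂`. -/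
lemma CategoryTheory.ShortComplex.ShortExact.exists_extension {R : Type} [CommRing R]
    {S : ShortComplex (ModuleCat.{0} R)} (hS : S.ShortExact) {Y : ModuleCat.{0} R}
    (h : Subsingleton (Abelian.Ext S.X₃ Y 1)) (f : S.X₁ ⟶ Y) : ∃ g : S.X₂ ⟶ Y, S.f ≫ g = f := by
  obtain ⟨y, hy⟩ := Abelian.Ext.contravariant_sequence_exact₁ hS Y (Abelian.Ext.mk₀ f)
    (add_zero 1) (Subsingleton.elim _ _)
  obtain ⟨g, rfl⟩ := (Abelian.Ext.mk₀_bijective _ _).2 y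
  rw [Abelian.Ext.mk₀_comp_mk₀] at hy
  exact ⟨g, (Abelian.Ext.mk₀_bijective _ _).1 hy⟩

/-- The class of modules without `Ext` in degree `n` is closed under finite powers. -/
lemma subsingleton_ext_pi {R : Type} [CommRing R] {M N : Type} [AddCommGroup M] [Module R M]
    [AddCommGroup N] [Module R N] (ι : Type) [Fintype ι] [DecidableEq ι] (n : ℕ)
    (h : Subsingleton (Abelian.Ext (ModuleCat.of R M) (ModuleCat.of R N) n)) :
    Subsingleton (Abelian.Ext (ModuleCat.of R (ι → M)) (ModuleCat.of R N) n) := by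
  have hid : 𝟙 (ModuleCat.of R (ι → M)) =
      ∑ i, ModuleCat.ofHom (LinearMap.proj i) ≫
        ModuleCat.ofHom (LinearMap.single R (fun _ : ι => M) i) := by
    ext1
    simp only [ModuleCat.hom_sum, ModuleCat.hom_comp, ModuleCat.hom_ofHom]
    ext x j
    simp [Finset.sum_apply, Pi.single_apply]
  refine subsingleton_of_forall_eq 0 fun x => ?_
  rw [← Abelian.Ext.mk₀_id_comp x, hid, Abelian.Ext.mk₀_sum, Abelian.Ext.sum_comp]
  refine Finset.sum_eq_zero fun i _ => ?_
  rw [← Abelian.Ext.mk₀_comp_mk₀_assoc,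
    Subsingleton.elim ((Abelian.Ext.mk₀ _).comp x _) 0, Abelian.Ext.comp_zero]

variable {A : Type} [CommRing A] {C : Type} [AddCommGroup C] [Module A C]

/-- As an `A`-module, `A ⋉ C` is the direct sum of `A` and `C`. -/
lemma subsingleton_ext_trivSqZeroExt {N : Type} [AddCommGroup N] [Module A N] (n : ℕ)
    (hA : Subsingleton (Abelian.Ext (ModuleCat.of A A) (ModuleCat.of A N) n))
    (hC : Subsingleton (Abelian.Ext (ModuleCat.of A C) (ModuleCat.of A N) n)) :
    Subsingleton
      (Abelian.Ext (ModuleCat.of A (TrivSqZeroExt A C)) (ModuleCat.of A N) n) := by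
  have hid : 𝟙 (ModuleCat.of A (TrivSqZeroExt A C)) =
      ModuleCat.ofHom (fstHom A A C).toLinearMap ≫ ModuleCat.ofHom (inlAlgHom A A C).toLinearMap +
        ModuleCat.ofHom (sndHom A C) ≫ ModuleCat.ofHom (inrHom A C) := by
    ext1
    ext1 x
    exact (inl_fst_add_inr_snd_eq x).symm
  refine subsingleton_of_forall_eq 0 fun x => ?_
  rw [← Abelian.Ext.mk₀_id_comp x, hid, Abelian.Ext.mk₀_add, Abelian.Ext.add_comp,
    ← Abelian.Ext.mk₀_comp_mk₀_assoc, ← Abelian.Ext.mk₀_comp_mk₀_assoc,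
    Subsingleton.elim
      ((Abelian.Ext.mk₀ (ModuleCat.ofHom (inlAlgHom A A C).toLinearMap)).comp x _) 0,
    Subsingleton.elim ((Abelian.Ext.mk₀ (ModuleCat.ofHom (inrHom A C))).comp x _) 0,
    Abelian.Ext.comp_zero, Abelian.Ext.comp_zero, add_zero]

section Hom

variable {M : Type} [AddCommGroup M] [Module (TrivSqZeroExt A C) M]

/-- If `C` is faithful, elements of `A ⋉ C` killed by `C` have zero first component, hence so have
the images of elements killed by `C`. -/
lemma fst_apply_eq_zero (hinj : Function.Injective (LinearMap.lsmul A C))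
    (φ : M →ₗ[TrivSqZeroExt A C] TrivSqZeroExt A C) {m : M}
    (hm : ∀ c : C, (inr c : TrivSqZeroExt A C) • m = 0) : (φ m).fst = 0 := by
  refine hinj (LinearMap.ext fun c => ?_)
  simpa [hm c] using (congrArg snd (φ.map_smul (inr c) m)).symm

/-- If `C` is faithful, a linear map to `A ⋉ C` is determined by its second component. -/
lemma linearMap_ext_snd (hinj : Function.Injective (LinearMap.lsmul A C))
    {φ ψ : M →ₗ[TrivSqZeroExt A C] TrivSqZeroExt A C} (h : ∀ m, (φ m).snd = (ψ m).snd) :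
    φ = ψ := by
  ext m
  · refine hinj (LinearMap.ext fun c => ?_)
    simpa using h ((inr c : TrivSqZeroExt A C) • m)
  · exact h m

variable [Module A M] [IsScalarTower A (TrivSqZeroExt A C) M]

/-- If every endomorphism of `C` is a homothety, an `A`-linear map `M → C` is the second component
of an `A ⋉ C`-linear map `M → A ⋉ C`. -/
lemma exists_linearMap_snd (hbij : Function.Bijective (LinearMap.lsmul A C)) (ψ : M →ₗ[A] C) :
    ∃ φ : M →ₗ[TrivSqZeroExt A C] TrivSqZeroExt A C, ∀ m, (φ m).snd = ψ m := by
  have hsmul (r : TrivSqZeroExt A C) (m : M) :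
      r • m = r.fst • m + (inr r.snd : TrivSqZeroExt A C) • m := by
    conv_lhs => rw [← inl_fst_add_inr_snd_eq r, add_smul]
    rw [← algebraMap_smul (TrivSqZeroExt A C) r.fst m]
    rfl
  have key (m : M) : ∃ a : A, ∀ c : C, a • c = ψ ((inr c : TrivSqZeroExt A C) • m) := by
    obtain ⟨a, ha⟩ := hbij.2
      { toFun := fun c => ψ ((inr c : TrivSqZeroExt A C) • m)
        map_add' := fun c d => by rw [inr_add, add_smul, map_add]
        map_smul' := fun b c => by rw [inr_smul, smul_assoc, map_smul]; rfl }
    exact ⟨a, fun c => LinearMap.congr_fun ha c⟩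
  choose f hf using key
  have huniq {a b : A} (h : ∀ c : C, a • c = b • c) : a = b := hbij.1 (LinearMap.ext h)
  refine ⟨{ toFun := fun m => inl (f m) + inr (ψ m), map_add' := fun m m' => ?_,
            map_smul' := fun r m => ?_ }, fun m => by simp⟩
  · ext
    · simpa using huniq fun c => by rw [hf, add_smul, hf, hf, smul_add, map_add]
    · simp
  · ext
    · simp only [fst_add, fst_inl, fst_inr, add_zero, RingHom.id_apply, smul_eq_mul, fst_mul]
      refine huniq fun c => ?_
      rw [hf, mul_smul, hf, smul_smul, ← map_smul, ← smul_assoc, ← inr_smul]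
      congr 2
      ext <;> simp
    · simp [hsmul r m, hf]

end Hom

/-- If `C` is semi-dualizing, every finitely generated `A ⋉ C`-module `M` with `Ext^i_A(M, C) = 0`
for all `i ≥ 1` satisfies `Ext^i_{A ⋉ C}(M, A ⋉ C) = 0` for all `i ≥ 1`. -/
lemma IsSemidualizing.subsingleton_ext [IsNoetherianRing A] (hC : IsSemidualizing A C) (n : ℕ)
    (M : Type) [AddCommGroup M] [Module A M] [Module (TrivSqZeroExt A C) M]
    [IsScalarTower A (TrivSqZeroExt A C) M] [Module.Finite (TrivSqZeroExt A C) M]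
    (hM : ∀ i : ℕ, Subsingleton (Abelian.Ext (ModuleCat.of A M) (ModuleCat.of A C) (i + 1))) :
    Subsingleton (Abelian.Ext (ModuleCat.of (TrivSqZeroExt A C) M)
      (ModuleCat.of (TrivSqZeroExt A C) (TrivSqZeroExt A C)) (n + 1)) := by
  have hfin : Module.Finite A C := hC.1
  have hR : IsNoetherian A (TrivSqZeroExt A C) := inferInstanceAs (IsNoetherian A (A × C))
  have hR' : IsNoetherianRing (TrivSqZeroExt A C) := isNoetherian_of_tower A hR
  obtain ⟨k, f, hf⟩ := Module.Finite.exists_fin' (TrivSqZeroExt A C) M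
  have hS := LinearMap.shortExact_shortComplexKer hf
  let S' : ShortComplex (ModuleCat.{0} A) := ModuleCat.shortComplexOfCompEqZero
    ((LinearMap.ker f).subtype.restrictScalars A) (f.restrictScalars A) (by ext x; exact x.2)
  have hS' : S'.ShortExact := by
    refine ModuleCat.shortComplex_shortExact _ (fun x => ?_) Subtype.val_injective hf
    exact ⟨fun h => ⟨⟨x, h⟩, rfl⟩, fun ⟨y, hy⟩ => hy ▸ y.2⟩
  have hF (i : ℕ) : Subsingleton (Abelian.Ext S'.X₂ (ModuleCat.of A C) (i + 1)) := by
    refine subsingleton_ext_pi (Fin k) (i + 1) (subsingleton_ext_trivSqZeroExt (i + 1) ?_ ?_)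
    · exact Abelian.Ext.subsingleton_of_projective _ _ _
    · exact (subsingleton_extGroup_iff i).1 (hC.2.2 (i + 1) (by lia))
  have hproj : Projective (LinearMap.shortComplexKer f).X₂ :=
    ModuleCat.projective_of_free (Pi.basisFun _ _)
  refine subsingleton_of_forall_eq 0 fun x => ?_
  obtain ⟨y, rfl⟩ := Abelian.Ext.contravariant_sequence_exact₃ hS _ x
    (Abelian.Ext.eq_zero_of_projective _) (add_comm 1 n)
  cases n with
  | succ n =>
    have := hC.subsingleton_ext n (LinearMap.ker f) fun i =>
      hS'.subsingleton_ext_X₁ _ (i + 1) (hF i) (hM (i + 1))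
    rw [Subsingleton.elim y 0, Abelian.Ext.comp_zero]
  | zero =>
    obtain ⟨φ, rfl⟩ := (Abelian.Ext.mk₀_bijective _ _).2 y
    obtain ⟨g, hg⟩ := hS'.exists_extension (hM 0) (ModuleCat.ofHom
      ((sndHom A C).comp (φ.hom.restrictScalars A)))
    obtain ⟨ψ, hψ⟩ := exists_linearMap_snd hC.2.1 g.hom
    have hφ : φ = (LinearMap.shortComplexKer f).f ≫ ModuleCat.ofHom ψ := by
      ext1
      refine linearMap_ext_snd hC.2.1.1 fun m => ?_
      exact ((hψ _).trans (LinearMap.congr_fun (congrArg ModuleCat.Hom.hom hg) m)).symm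
    rw [hφ, ← Abelian.Ext.mk₀_comp_mk₀]
    exact hS.extClass_comp_assoc _

end

/-- If `A` is a commutative noetherian ring, `C` a semi-dualizing `A`-module
and `R = A ⋉ C`, then `A` and `C`, viewed as `R`-modules via the projection `R → A`, are
finitely generated totally reflexive `R`-modules: `Ext^i_R(A, R) = 0` and `Ext^i_R(C, R) = 0`
for all `i ≥ 1`, and the biduality maps `A → Hom_R(Hom_R(A, R), R)` and
`C → Hom_R(Hom_R(C, R), R)` (sending `x` to evaluation at `x`) are isomorphisms. -/
theorem totally_reflexive_over_trivSqZeroExt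
    (A : Type) [CommRing A] [IsNoetherianRing A] (C : Type) [AddCommGroup C] [Module A C]
    (hC : IsSemidualizing A C) :
    letI : Module (TrivSqZeroExt A C) A := moduleOfFst A C A
    letI : Module (TrivSqZeroExt A C) C := moduleOfFst A C C
    Module.Finite (TrivSqZeroExt A C) A ∧ Module.Finite (TrivSqZeroExt A C) C ∧
      (∀ i : ℕ, 1 ≤ i → Subsingleton (ExtGroup (TrivSqZeroExt A C) i A (TrivSqZeroExt A C))) ∧
      (∀ i : ℕ, 1 ≤ i → Subsingleton (ExtGroup (TrivSqZeroExt A C) i C (TrivSqZeroExt A C))) ∧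
      Function.Bijective (Module.Dual.eval (TrivSqZeroExt A C) A) ∧
      Function.Bijective (Module.Dual.eval (TrivSqZeroExt A C) C) := by
  let : Module (TrivSqZeroExt A C) A := moduleOfFst A C A
  let : Module (TrivSqZeroExt A C) C := moduleOfFst A C C
  have hsA (r : TrivSqZeroExt A C) (x : A) : r • x = r.fst • x := rfl
  have hsC (r : TrivSqZeroExt A C) (x : C) : r • x = r.fst • x := rfl
  have htA : IsScalarTower A (TrivSqZeroExt A C) A := ⟨fun a r x => by simp [hsA, mul_assoc]⟩
  have htC : IsScalarTower A (TrivSqZeroExt A C) C := ⟨fun a r x => by simp [hsC, mul_smul]⟩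
  have hfin : Module.Finite A C := hC.1
  have hfA : Module.Finite (TrivSqZeroExt A C) A :=
    Module.Finite.of_restrictScalars_finite A (TrivSqZeroExt A C) A
  have hfC : Module.Finite (TrivSqZeroExt A C) C :=
    Module.Finite.of_restrictScalars_finite A (TrivSqZeroExt A C) C
  refine ⟨hfA, hfC, fun i hi => ?_, fun i hi => ?_, ?_, ?_⟩
  · obtain ⟨n, rfl⟩ := Nat.exists_eq_add_of_le' hi
    exact (subsingleton_extGroup_iff n).2
      (hC.subsingleton_ext n A fun i => CategoryTheory.Abelian.Ext.subsingleton_of_projective _ _ _)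
  · obtain ⟨n, rfl⟩ := Nat.exists_eq_add_of_le' hi
    exact (subsingleton_extGroup_iff n).2 (hC.subsingleton_ext n C fun i =>
      (subsingleton_extGroup_iff i).1 (hC.2.2 (i + 1) (by lia)))
  · choose φ hφ using fun c : C => exists_linearMap_snd hC.2.1 (LinearMap.toSpanSingleton A C c)
    have hφ' (c : C) (x : A) : (φ c x).snd = x • c := hφ c x
    constructor
    · refine (injective_iff_map_eq_zero _).2 fun x hx => hC.2.1.1 (LinearMap.ext fun c => ?_)
      have := congrArg snd (LinearMap.congr_fun hx (φ c))
      simpa [hφ'] using this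
    · intro Ψ
      have hadd (c d : C) : φ (c + d) = φ c + φ d :=
        linearMap_ext_snd hC.2.1.1 fun x => by simp [hφ']
      have hsmul (a : A) (c : C) : φ (a • c) = (inl a : TrivSqZeroExt A C) • φ c :=
        linearMap_ext_snd hC.2.1.1 fun x => by rw [hφ', smul_comm]; simp [hφ']
      obtain ⟨a, ha⟩ := hC.2.1.2
        { toFun := fun c => (Ψ (φ c)).snd
          map_add' := fun c d => by simp [hadd]
          map_smul' := fun a c => by simp [hsmul] }
      refine ⟨a, LinearMap.ext fun χ => TrivSqZeroExt.ext ?_ ?_⟩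
      · rw [fst_apply_eq_zero hC.2.1.1 Ψ, Module.Dual.eval_apply, fst_apply_eq_zero hC.2.1.1 χ]
        · intro c
          simp [hsA]
        · refine fun c => LinearMap.ext fun x => ?_
          rw [LinearMap.smul_apply, ← map_smul, hsA]
          simp
      · have hχ : χ = φ (χ 1).snd := linearMap_ext_snd hC.2.1.1 fun x => by
          rw [hφ']
          simpa [hsA] using congrArg snd (χ.map_smul (inl x) 1)
        rw [Module.Dual.eval_apply, hχ, hφ']
        exact LinearMap.congr_fun ha _
  · obtain ⟨φ, hφ⟩ := exists_linearMap_snd hC.2.1 (LinearMap.id : C →ₗ[A] C)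
    have hzero (x c : C) : (inr c : TrivSqZeroExt A C) • x = 0 := by simp [hsC]
    have hdual (χ : Module.Dual (TrivSqZeroExt A C) C) (c : C) :
        (inr c : TrivSqZeroExt A C) • χ = 0 :=
      LinearMap.ext fun x => by rw [LinearMap.smul_apply, ← map_smul, hzero, map_zero]; rfl
    constructor
    · refine (injective_iff_map_eq_zero _).2 fun x hx => ?_
      simpa [hφ] using congrArg snd (LinearMap.congr_fun hx φ)
    · refine fun Ψ => ⟨(Ψ φ).snd, LinearMap.ext fun χ => TrivSqZeroExt.ext ?_ ?_⟩
      · rw [fst_apply_eq_zero hC.2.1.1 Ψ (hdual χ), Module.Dual.eval_apply,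
          fst_apply_eq_zero hC.2.1.1 χ (hzero _)]
      · obtain ⟨a, ha⟩ := hC.2.1.2 ((sndHom A C).comp (χ.restrictScalars A))
        have ha' (c : C) : (χ c).snd = a • c := (LinearMap.congr_fun ha c).symm
        have hχ : χ = (inl a : TrivSqZeroExt A C) • φ :=
          linearMap_ext_snd hC.2.1.1 fun x => by simp [ha', hφ]
        rw [Module.Dual.eval_apply, ha', hχ, map_smul]
        simp
end

section
/- Let R be a commutative noetherian local ring with maximal ideal m and residue field k = R/m, and let E be an injective hull of k over R (an injective R-module containing k as an essential submodule). Then R has finite injective dimension as a module over itself (i.e., R is a Gorenstein local ring) if and only if Ext^i_R(E, k) = 0 for all sufficiently large i. -/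
/-- A module `M` over a commutative ring `R` has finite injective dimension:
equivalently (and this is how we phrase it), there is an `n` such that
`Ext^i_R(N, M) = 0` for all `i > n` and all `R`-modules `N`. -/
def HasFiniteInjDim (R : Type) [CommRing R] (M : Type) [AddCommGroup M] [Module R M] : Prop :=
  ∃ n : ℕ, ∀ i : ℕ, n < i → ∀ (N : Type) [AddCommGroup N] [Module R N],
    Subsingleton (ExtGroup R i N M)

section Homological

open CategoryTheory

variable {R : Type} [CommRing R]

/-- Positive-degree `Ext` groups, in terms of cocycles on a projective resolution. -/
theorem subsingleton_abelianExt_succ_iff_resolution {X : ModuleCat.{0} R}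
    (P : ProjectiveResolution X) (Y : ModuleCat.{0} R) (i : ℕ) :
    Subsingleton (Abelian.Ext X Y (i + 1)) ↔
      ∀ f : P.complex.X (i + 1) ⟶ Y, P.complex.d (i + 2) (i + 1) ≫ f = 0 →
        ∃ g : P.complex.X i ⟶ Y, P.complex.d (i + 1) i ≫ g = f := by
  constructor
  · intro h f hf
    exact (P.extMk_eq_zero_iff f (i + 2) rfl hf i rfl).1 (Subsingleton.elim _ _)
  · intro h
    refine subsingleton_of_forall_eq 0 fun α => ?_
    obtain ⟨f, hf, rfl⟩ := P.extMk_surjective α (i + 2) rfl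
    exact (P.extMk_eq_zero_iff f (i + 2) rfl hf i rfl).2 (h f hf)

theorem subsingleton_derivedExt_succ_iff_resolution {X : ModuleCat.{0} R}
    (P : ProjectiveResolution X) (Y : ModuleCat.{0} R) (i : ℕ) :
    Subsingleton (((Ext R (ModuleCat.{0} R) (i + 1)).obj (Opposite.op X)).obj Y) ↔
      ∀ f : P.complex.X (i + 1) ⟶ Y, P.complex.d (i + 2) (i + 1) ≫ f = 0 →
        ∃ g : P.complex.X i ⟶ Y, P.complex.d (i + 1) i ≫ g = f := by
  rw [← ModuleCat.isZero_iff_subsingleton, (P.isoExt (i + 1) Y).isZero_iff,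
    ← HomologicalComplex.exactAt_iff_isZero_homology,
    HomologicalComplex.exactAt_iff' _ i (i + 1) (i + 2) (by simp) (by simp),
    ShortComplex.moduleCat_exact_iff]
  rfl

theorem subsingleton_extGroup_succ_iff (M N : Type) [AddCommGroup M] [Module R M]
    [AddCommGroup N] [Module R N] (i : ℕ) :
    Subsingleton (ExtGroup R (i + 1) M N) ↔
      Subsingleton (Abelian.Ext (ModuleCat.of R M) (ModuleCat.of R N) (i + 1)) := by
  rw [subsingleton_abelianExt_succ_iff_resolution (ProjectiveResolution.of (ModuleCat.of R M))]
  exact subsingleton_derivedExt_succ_iff_resolution _ _ _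

variable {S : ShortComplex (ModuleCat.{0} R)}

theorem subsingleton_ext_one_iff_of_projective (hS : S.ShortExact) [Projective S.X₂]
    (Y : ModuleCat.{0} R) :
    Subsingleton (Abelian.Ext S.X₃ Y 1) ↔ ∀ g : S.X₁ ⟶ Y, ∃ h : S.X₂ ⟶ Y, S.f ≫ h = g := by
  constructor
  · intro _ g
    obtain ⟨x, hx⟩ := Abelian.Ext.contravariant_sequence_exact₁ hS Y (Abelian.Ext.mk₀ g)
      (add_zero 1) (Subsingleton.elim _ _)
    obtain ⟨h, rfl⟩ := Abelian.Ext.homEquiv₀.symm.surjective x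
    refine ⟨h, Abelian.Ext.homEquiv₀.symm.injective ?_⟩
    simpa using hx
  · intro h
    refine subsingleton_of_forall_eq 0 fun α => ?_
    obtain ⟨x, rfl⟩ := precomp_extClass_surjective_of_projective_X₂ Y hS 0 α
    obtain ⟨g, rfl⟩ := Abelian.Ext.homEquiv₀.symm.surjective x
    obtain ⟨h, rfl⟩ := h g
    simp [← Abelian.Ext.mk₀_comp_mk₀]

theorem subsingleton_ext_one_iff_of_injective (hS : S.ShortExact) [Injective S.X₂]
    (X : ModuleCat.{0} R) :
    Subsingleton (Abelian.Ext X S.X₁ 1) ↔ ∀ g : X ⟶ S.X₃, ∃ h : X ⟶ S.X₂, h ≫ S.g = g := by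
  constructor
  · intro _ g
    obtain ⟨x, hx⟩ := Abelian.Ext.covariant_sequence_exact₃ X hS (Abelian.Ext.mk₀ g)
      (zero_add 1) (Subsingleton.elim _ _)
    obtain ⟨h, rfl⟩ := Abelian.Ext.homEquiv₀.symm.surjective x
    refine ⟨h, Abelian.Ext.homEquiv₀.symm.injective ?_⟩
    simpa using hx
  · intro h
    refine subsingleton_of_forall_eq 0 fun α => ?_
    obtain ⟨x, rfl⟩ := postcomp_extClass_surjective_of_projective_X₂ hS X 0 α
    obtain ⟨g, rfl⟩ := Abelian.Ext.homEquiv₀.symm.surjective x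
    obtain ⟨h, rfl⟩ := h g
    simp [← Abelian.Ext.mk₀_comp_mk₀]

theorem subsingleton_ext_succ_iff_of_projective (hS : S.ShortExact) [Projective S.X₂]
    (Y : ModuleCat.{0} R) (i : ℕ) :
    Subsingleton (Abelian.Ext S.X₃ Y (i + 2)) ↔ Subsingleton (Abelian.Ext S.X₁ Y (i + 1)) := by
  constructor
  · intro _
    refine subsingleton_of_forall_eq 0 fun x => ?_
    obtain ⟨y, rfl⟩ := Abelian.Ext.contravariant_sequence_exact₁ hS Y x
      (add_comm 1 (i + 1)) (Subsingleton.elim _ _)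
    simp [Abelian.Ext.eq_zero_of_projective y]
  · intro _
    exact (precomp_extClass_surjective_of_projective_X₂ Y hS (i + 1)).subsingleton

theorem subsingleton_ext_succ_iff_of_injective (hS : S.ShortExact) [Injective S.X₂]
    (X : ModuleCat.{0} R) (i : ℕ) :
    Subsingleton (Abelian.Ext X S.X₁ (i + 2)) ↔ Subsingleton (Abelian.Ext X S.X₃ (i + 1)) := by
  constructor
  · intro _
    refine subsingleton_of_forall_eq 0 fun x => ?_
    obtain ⟨y, rfl⟩ := Abelian.Ext.covariant_sequence_exact₃ X hS x
      (rfl : i + 1 + 1 = i + 2) (Subsingleton.elim _ _)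
    simp [Abelian.Ext.eq_zero_of_injective y]
  · intro _
    exact (postcomp_extClass_surjective_of_projective_X₂ hS X (i + 1)).subsingleton

end Homological

section InjectiveDimension

open CategoryTheory IsLocalRing

variable {R : Type} [CommRing R]

/-- A dimension-shifted Baer criterion. -/
theorem hasInjectiveDimensionLT_of_ext_quotient (n : ℕ) (M : ModuleCat.{0} R)
    (h : ∀ I : Ideal R, Subsingleton (Abelian.Ext (ModuleCat.of R (R ⧸ I)) M (n + 1))) :
    HasInjectiveDimensionLT M (n + 1) := by
  induction n generalizing M with
  | zero =>
    rw [← injective_iff_hasInjectiveDimensionLT_one]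
    have hB : Module.Baer R M := by
      intro I g
      have hS := LinearMap.shortExact_shortComplexKer (f := I.mkQ) I.mkQ_surjective
      have : Projective (I.mkQ.shortComplexKer).X₂ :=
        (IsProjective.iff_projective R).1 (inferInstance : Module.Projective R R)
      have key := (subsingleton_ext_one_iff_of_projective hS M).1 (h I)
      let e : LinearMap.ker I.mkQ ≃ₗ[R] I := LinearEquiv.ofEq _ _ I.ker_mkQ
      obtain ⟨g', hg'⟩ := key (ModuleCat.ofHom (g ∘ₗ e.toLinearMap))
      refine ⟨g'.hom, fun x hx => ?_⟩
      exact LinearMap.congr_fun (congrArg ModuleCat.Hom.hom hg') (e.symm ⟨x, hx⟩)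
    have := hB.injective
    exact Module.injective_object_of_injective_module R M
  | succ n ih =>
    let p := Classical.choice (EnoughInjectives.presentation M)
    let S : ShortComplex (ModuleCat.{0} R) := ShortComplex.mk _ _ (Limits.cokernel.condition p.f)
    have hS : S.ShortExact := { exact := ShortComplex.exact_cokernel p.f }
    have hI : Injective S.X₂ := p.injective
    rw [← hS.hasInjectiveDimensionLT_X₃_iff n hI]
    exact ih _ fun I => (subsingleton_ext_succ_iff_of_injective hS _ n).1 (h I)

/-- The short complex `R ⧸ K → R ⧸ J → R ⧸ (J + aR)` whose first map is multiplication by `a`. -/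
abbrev quotientMulComplex (J K : Ideal R) (a : R) (hK : ∀ r, r ∈ K ↔ a * r ∈ J) :
    ShortComplex (ModuleCat.{0} R) :=
  ModuleCat.shortComplexOfCompEqZero
    (Submodule.mapQ K J (LinearMap.lsmul R R a) fun r hr => (hK r).1 hr)
    (Submodule.factor (le_sup_left : J ≤ J ⊔ Ideal.span {a})) (by
      ext
      refine (Submodule.Quotient.mk_eq_zero _).2 (Ideal.mem_sup_right ?_)
      exact Ideal.mem_span_singleton'.2 ⟨1, mul_comm _ _⟩)

theorem shortExact_quotientMulComplex (J K : Ideal R) (a : R) (hK : ∀ r, r ∈ K ↔ a * r ∈ J) :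
    (quotientMulComplex J K a hK).ShortExact := by
  refine ModuleCat.shortComplex_shortExact _ ?_ ?_ ?_
  · intro y
    obtain ⟨y, rfl⟩ := Submodule.Quotient.mk_surjective _ y
    constructor
    · intro hy
      have hy : y ∈ J ⊔ Ideal.span {a} := (Submodule.Quotient.mk_eq_zero _).1 hy
      obtain ⟨j, hj, c, hc, rfl⟩ := Submodule.mem_sup.1 hy
      obtain ⟨r, rfl⟩ := Ideal.mem_span_singleton'.1 hc
      refine ⟨Submodule.Quotient.mk r, (Submodule.Quotient.eq J).2 ?_⟩
      have : (LinearMap.lsmul R R a) r - (j + r * a) = -j := by simp; ring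
      rw [this]
      exact J.neg_mem hj
    · rintro ⟨x, hx⟩
      obtain ⟨x, rfl⟩ := Submodule.Quotient.mk_surjective _ x
      rw [← hx]
      refine (Submodule.Quotient.mk_eq_zero _).2 ?_
      exact Ideal.mem_sup_right (Ideal.mem_span_singleton'.2 ⟨x, mul_comm _ _⟩)
  · refine (injective_iff_map_eq_zero'
      (Submodule.mapQ K J (LinearMap.lsmul R R a) fun r hr => (hK r).1 hr)).2 fun x => ?_
    obtain ⟨x, rfl⟩ := Submodule.Quotient.mk_surjective _ x
    exact (Submodule.Quotient.mk_eq_zero J).trans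
      ((hK x).symm.trans (Submodule.Quotient.mk_eq_zero K).symm)
  · exact Submodule.factor_surjective (le_sup_left : J ≤ J ⊔ Ideal.span {a})

variable [IsNoetherianRing R] [IsLocalRing R]

theorem subsingleton_ext_quotient_of_residueField (M : ModuleCat.{0} R) [Module.Finite R M]
    (n : ℕ)
    (h : ∀ i, n ≤ i → Subsingleton (Abelian.Ext (ModuleCat.of R (ResidueField R)) M i))
    (J : Ideal R) (i : ℕ) (hi : n ≤ i) :
    Subsingleton (Abelian.Ext (ModuleCat.of R (R ⧸ J)) M i) := by
  induction J using WellFoundedGT.induction generalizing i with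
  | _ J ih =>
  by_cases hm : J = maximalIdeal R
  · subst hm
    exact h i hi
  by_cases ht : J = ⊤
  · subst ht
    have hz : Limits.IsZero (ModuleCat.of R (R ⧸ (⊤ : Ideal R))) :=
      ModuleCat.isZero_of_subsingleton _
    refine subsingleton_of_forall_eq 0 fun α => ?_
    rw [← Abelian.Ext.mk₀_id_comp α, hz.eq_of_src (𝟙 _) 0]
    simp
  have hlt : J < maximalIdeal R := lt_of_le_of_ne (le_maximalIdeal ht) hm
  by_cases hc : ∃ a ∉ J, ∃ b ∉ J, a * b ∈ J
  · obtain ⟨a, ha, b, hb, hab⟩ := hc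
    let K : Ideal R := Submodule.comap (LinearMap.lsmul R R a) J
    have hS := shortExact_quotientMulComplex J K a fun r => Iff.rfl
    have h1 := ih K (SetLike.lt_iff_le_and_exists.2
      ⟨fun x hx => J.mul_mem_left a hx, b, hab, hb⟩) i hi
    have h3 := ih (J ⊔ Ideal.span {a}) (left_lt_sup.2 fun hle =>
      ha (hle (Ideal.mem_span_singleton_self a))) i hi
    refine subsingleton_of_forall_eq 0 fun α => ?_
    obtain ⟨β, rfl⟩ := Abelian.Ext.contravariant_sequence_exact₂ hS M α
      (h1.elim _ _)
    rw [h3.elim β 0, Abelian.Ext.comp_zero]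
  · push Not at hc
    obtain ⟨-, a, ham, haJ⟩ := SetLike.lt_iff_le_and_exists.1 hlt
    have hS := shortExact_quotientMulComplex J J a fun r =>
      ⟨fun hr => J.mul_mem_left a hr, fun hr => by_contra fun hn => hc a haJ r hn hr⟩
    have h3 := ih (J ⊔ Ideal.span {a}) (left_lt_sup.2 fun hle =>
      haJ (hle (Ideal.mem_span_singleton_self a))) (1 + i) (by lia)
    have hf : (quotientMulComplex J J a fun r =>
      ⟨fun hr => J.mul_mem_left a hr, fun hr => by_contra fun hn => hc a haJ r hn hr⟩).f =
        a • 𝟙 (ModuleCat.of R (R ⧸ J)) := by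
      ext
      rfl
    have hsurj (α : Abelian.Ext (ModuleCat.of R (R ⧸ J)) M i) : ∃ β, a • β = α := by
      obtain ⟨β, hβ⟩ := Abelian.Ext.contravariant_sequence_exact₁ hS M α rfl (h3.elim _ _)
      refine ⟨β, ?_⟩
      rw [← hβ, hf]
      simp [Abelian.Ext.mk₀_smul]
    have : (⊤ : Submodule R (Abelian.Ext (ModuleCat.of R (R ⧸ J)) M i)) = ⊥ := by
      refine Submodule.eq_bot_of_le_smul_of_le_jacobson_bot (Ideal.span {a}) _
        Module.Finite.fg_top ?_ ?_
      · intro α _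
        obtain ⟨β, rfl⟩ := hsurj α
        exact Submodule.smul_mem_smul (Ideal.mem_span_singleton_self a) trivial
      · rw [jacobson_eq_maximalIdeal ⊥ bot_ne_top, Ideal.span_singleton_le_iff_mem]
        exact ham
    exact (Submodule.subsingleton_iff R).1 (subsingleton_of_bot_eq_top this.symm)

theorem hasFiniteInjDim_iff_ext_residueField (M : Type) [AddCommGroup M] [Module R M]
    [Module.Finite R M] :
    HasFiniteInjDim R M ↔ ∃ n, ∀ i, n ≤ i → Subsingleton (Abelian.Ext
      (ModuleCat.of R (ResidueField R)) (ModuleCat.of R M) (i + 1)) := by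
  constructor
  · rintro ⟨n, hn⟩
    exact ⟨n, fun i hi => (subsingleton_extGroup_succ_iff _ _ _).1 (hn (i + 1) (by lia) _)⟩
  · rintro ⟨n, hn⟩
    have := hasInjectiveDimensionLT_of_ext_quotient n (ModuleCat.of R M) fun I =>
      subsingleton_ext_quotient_of_residueField (ModuleCat.of R M) (n + 1) (fun i hi => by
        obtain ⟨j, rfl⟩ := Nat.exists_eq_add_of_le' (show 1 ≤ i by lia)
        exact hn j (by lia)) I (n + 1) le_rfl
    refine ⟨n, fun i hi N _ _ => ?_⟩
    obtain ⟨j, rfl⟩ := Nat.exists_eq_add_of_le' (show 1 ≤ i by lia)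
    exact (subsingleton_extGroup_succ_iff _ _ _).2
      (HasInjectiveDimensionLT.subsingleton _ (n + 1) _ (by lia) _)

end InjectiveDimension

section Duality

open TensorProduct

variable {R : Type} [CommRing R] {E : Type} [AddCommGroup E] [Module R E]

/-- A module `E` such that every nonzero element of every module is detected by a map to `E`. -/
def IsCogeneratorModule (R E : Type) [CommRing R] [AddCommGroup E] [Module R E] : Prop :=
  ∀ (X : Type) [AddCommGroup X] [Module R X] (x : X), x ≠ 0 → ∃ φ : X →ₗ[R] E, φ x ≠ 0

/-- Dualizing into an injective module preserves exactness. -/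
theorem exact_lcomp_of_injective (hE : Module.Injective R E) {X Y Z : Type}
    [AddCommGroup X] [Module R X] [AddCommGroup Y] [Module R Y] [AddCommGroup Z] [Module R Z]
    {f : X →ₗ[R] Y} {g : Y →ₗ[R] Z} (h : Function.Exact f g) :
    Function.Exact (LinearMap.lcomp R E g) (LinearMap.lcomp R E f) := by
  intro φ
  constructor
  · intro hφ
    have hle : LinearMap.ker g ≤ LinearMap.ker φ := by
      intro y hy
      obtain ⟨x, rfl⟩ := (h y).1 hy
      exact LinearMap.congr_fun hφ x
    obtain ⟨ψ, hψ⟩ := hE.out ((LinearMap.ker g).liftQ g le_rfl)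
      (LinearMap.ker_eq_bot.1 (Submodule.ker_liftQ_eq_bot _ _ _ le_rfl))
      ((LinearMap.ker g).liftQ φ hle)
    exact ⟨ψ, LinearMap.ext fun y => hψ (Submodule.Quotient.mk y)⟩
  · rintro ⟨ψ, rfl⟩
    ext x
    simp [h.apply_apply_eq_zero]

theorem surjective_lcomp_iff (hE : Module.Injective R E) (hc : IsCogeneratorModule R E)
    {X Y : Type} [AddCommGroup X] [Module R X] [AddCommGroup Y] [Module R Y] (f : X →ₗ[R] Y) :
    Function.Surjective (LinearMap.lcomp R E f) ↔ Function.Injective f := by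
  constructor
  · intro h
    refine (injective_iff_map_eq_zero f).2 fun x hx => by_contra fun hx0 => ?_
    obtain ⟨φ, hφ⟩ := hc X x hx0
    obtain ⟨ψ, rfl⟩ := h φ
    exact hφ (by simp [hx])
  · intro h φ
    obtain ⟨ψ, hψ⟩ := hE.out f h φ
    exact ⟨ψ, LinearMap.ext hψ⟩

theorem injective_lcomp_iff (hc : IsCogeneratorModule R E)
    {X Y : Type} [AddCommGroup X] [Module R X] [AddCommGroup Y] [Module R Y] (f : X →ₗ[R] Y) :
    Function.Injective (LinearMap.lcomp R E f) ↔ Function.Surjective f := by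
  constructor
  · intro h y
    by_contra hy
    obtain ⟨φ, hφ⟩ := hc (Y ⧸ LinearMap.range f) (Submodule.Quotient.mk y) (by
      rw [Ne, Submodule.Quotient.mk_eq_zero]
      exact hy)
    refine hφ (LinearMap.congr_fun (h (a₁ := φ ∘ₗ (LinearMap.range f).mkQ) (a₂ := 0) ?_) y)
    ext x
    have : (LinearMap.range f).mkQ (f x) = 0 :=
      (Submodule.Quotient.mk_eq_zero _).2 (LinearMap.mem_range_self f x)
    simp [this]
  · exact fun h => LinearMap.lcomp_injective_of_surjective f h

variable (R E) in
/-- The evaluation map `E ⊗ X → Hom(Hom(X, R), E)`. -/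
def tensorEval (X : Type) [AddCommGroup X] [Module R X] :
    E ⊗[R] X →ₗ[R] (X →ₗ[R] R) →ₗ[R] E :=
  TensorProduct.lift (LinearMap.mk₂ R
    (fun e x => LinearMap.toSpanSingleton R E e ∘ₗ LinearMap.applyₗ x)
    (fun _ _ _ => by ext; simp) (fun _ _ _ => by ext; exact smul_comm _ _ _)
    (fun _ _ _ => by ext; simp [add_smul]) (fun _ _ _ => by ext; simp [mul_smul]))

@[simp]
theorem tensorEval_tmul {X : Type} [AddCommGroup X] [Module R X] (e : E) (x : X)
    (φ : X →ₗ[R] R) : tensorEval R E X (e ⊗ₜ x) φ = φ x • e := by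
  simp [tensorEval]

theorem tensorEval_naturality {X Y : Type} [AddCommGroup X] [Module R X] [AddCommGroup Y]
    [Module R Y] (f : X →ₗ[R] Y) :
    LinearMap.lcomp R E (LinearMap.lcomp R R f) ∘ₗ tensorEval R E X =
      tensorEval R E Y ∘ₗ f.lTensor E := by
  ext e x φ
  simp

theorem bijective_tensorEval_of_basis {X I : Type} [AddCommGroup X] [Module R X] [Fintype I]
    (b : Module.Basis I R X) : Function.Bijective (tensorEval R E X) := by
  constructor
  · let r : ((X →ₗ[R] R) →ₗ[R] E) →ₗ[R] E ⊗[R] X :=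
      ∑ i, (TensorProduct.mk R E X).flip (b i) ∘ₗ LinearMap.applyₗ (b.coord i)
    have hr : r ∘ₗ tensorEval R E X = LinearMap.id := by
      ext e x
      simp only [r, AlgebraTensorModule.curry_apply, LinearMap.restrictScalars_self, curry_apply,
        LinearMap.comp_apply, LinearMap.sum_apply, LinearMap.applyₗ_apply_apply, tensorEval_tmul,
        LinearMap.flip_apply, mk_apply, smul_tmul, ← tmul_sum, Module.Basis.coord_apply, b.sum_repr,
        LinearMap.id_apply]
    exact Function.LeftInverse.injective (g := r) (LinearMap.congr_fun hr)
  · intro Ψ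
    refine ⟨∑ i, Ψ (b.coord i) ⊗ₜ b i, LinearMap.ext fun φ => ?_⟩
    have hφ : φ = ∑ i, φ (b i) • b.coord i := b.ext fun j => by simp
    conv_rhs => rw [hφ, map_sum]
    simp

theorem bijective_tensorEval [IsNoetherianRing R] (hE : Module.Injective R E)
    (X : Type) [AddCommGroup X] [Module R X] [Module.Finite R X] :
    Function.Bijective (tensorEval R E X) := by
  obtain ⟨n, f, hf⟩ := Module.Finite.exists_fin' R X
  obtain ⟨m, g, hg⟩ := Module.Finite.exists_fin' R (LinearMap.ker f)
  let g' : (Fin m → R) →ₗ[R] Fin n → R := (LinearMap.ker f).subtype ∘ₗ g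
  have hgf : Function.Exact g' f := by
    rw [LinearMap.exact_iff, LinearMap.range_comp_of_range_eq_top _ (LinearMap.range_eq_top.2 hg),
      Submodule.range_subtype]
  have hinj : Function.Injective (LinearMap.lcomp R R f) :=
    LinearMap.lcomp_injective_of_surjective f hf
  refine LinearMap.bijective_of_surjective_of_bijective_of_right_exact
    (g'.lTensor E) (f.lTensor E) _ _ (tensorEval R E _) (tensorEval R E _) _
    (tensorEval_naturality g') (tensorEval_naturality f) (lTensor_exact E hgf hf)
    (exact_lcomp_of_injective hE (LinearMap.exact_lcomp_of_exact_of_surjective R hgf hf))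
    (bijective_tensorEval_of_basis (Pi.basisFun R _)).2
    (bijective_tensorEval_of_basis (Pi.basisFun R _)) (LinearMap.lTensor_surjective E hf) ?_
  intro φ
  obtain ⟨ψ, hψ⟩ := hE.out _ hinj φ
  exact ⟨ψ, LinearMap.ext hψ⟩

/-- Lifting maps `E → Hom(X, E)` along `Hom(Y, E) → Hom(X, E)` amounts to extending maps
`X → R` along `X → Y`. -/
theorem surjective_lcomp_dual_iff [IsNoetherianRing R] (hE : Module.Injective R E)
    (hc : IsCogeneratorModule R E) {X Y : Type} [AddCommGroup X] [Module R X] [Module.Finite R X]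
    [AddCommGroup Y] [Module R Y] [Module.Finite R Y] (f : X →ₗ[R] Y) :
    (∀ φ : E →ₗ[R] X →ₗ[R] E, ∃ ψ : E →ₗ[R] Y →ₗ[R] E, LinearMap.lcomp R E f ∘ₗ ψ = φ) ↔
      Function.Surjective (LinearMap.lcomp R R f) := by
  rw [← injective_lcomp_iff hc]
  have h1 : Function.Injective (LinearMap.lcomp R E (LinearMap.lcomp R R f)) ↔
      Function.Injective (f.lTensor E) := by
    rw [← (bijective_tensorEval hE Y).1.of_comp_iff, ← LinearMap.coe_comp,
      ← tensorEval_naturality, LinearMap.coe_comp,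
      Function.Injective.of_comp_iff' _ (bijective_tensorEval hE X)]
  rw [h1, ← surjective_lcomp_iff hE hc]
  constructor
  · intro h φ
    obtain ⟨ψ, hψ⟩ := h (TensorProduct.curry φ)
    refine ⟨TensorProduct.lift ψ, TensorProduct.ext' fun e x => ?_⟩
    simpa using LinearMap.congr_fun (LinearMap.congr_fun hψ e) x
  · intro h φ
    obtain ⟨ψ, hψ⟩ := h (TensorProduct.lift φ)
    refine ⟨TensorProduct.curry ψ, LinearMap.ext₂ fun e x => ?_⟩
    simpa using LinearMap.congr_fun hψ (e ⊗ₜ x)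

theorem injective_dual_of_projective (hE : Module.Injective R E) (X : Type) [AddCommGroup X]
    [Module R X] [Module.Projective R X] : Module.Injective R (X →ₗ[R] E) where
  out A B _ _ _ _ f hf g := by
    obtain ⟨h, hh⟩ := hE.out (f.rTensor X) (Module.Flat.rTensor_preserves_injective_linearMap f hf)
      (TensorProduct.lift g)
    exact ⟨TensorProduct.curry h, fun a => LinearMap.ext fun x => by simpa using hh (a ⊗ₜ x)⟩

end Duality

section DualComplex

open CategoryTheory

variable {R : Type} [CommRing R] {X Y : Type} [AddCommGroup X] [Module R X]
  [AddCommGroup Y] [Module R Y]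

/-- The short complex `Hom(Y, E) → Hom(X, E) → Hom(ker f, E)` for a linear map `f : X → Y`. -/
noncomputable abbrev dualComplexKer (E : Type) [AddCommGroup E] [Module R E] (f : X →ₗ[R] Y) :
    ShortComplex (ModuleCat.{0} R) :=
  ModuleCat.shortComplexOfCompEqZero (LinearMap.lcomp R E f)
    (LinearMap.lcomp R E (LinearMap.ker f).subtype) (by ext; simp)

theorem shortExact_dualComplexKer {E : Type} [AddCommGroup E] [Module R E]
    (hE : Module.Injective R E) {f : X →ₗ[R] Y} (hf : Function.Surjective f) :
    (dualComplexKer E f).ShortExact := by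
  refine ModuleCat.shortComplex_shortExact _
    (exact_lcomp_of_injective hE (LinearMap.exact_subtype_ker_map f))
    (LinearMap.lcomp_injective_of_surjective f hf) fun φ => ?_
  obtain ⟨ψ, hψ⟩ := hE.out _ (LinearMap.ker f).injective_subtype φ
  exact ⟨ψ, LinearMap.ext hψ⟩

end DualComplex

section InjectiveHull

open CategoryTheory IsLocalRing

variable {R : Type} [CommRing R] {E : Type} [AddCommGroup E] [Module R E]

/-- Matlis-type duality between `Ext(E, Hom(N, E))` and `Ext(N, R)`. -/
theorem subsingleton_ext_dual_iff [IsNoetherianRing R] (hE : Module.Injective R E)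
    (hc : IsCogeneratorModule R E) (i : ℕ) (N : Type) [AddCommGroup N] [Module R N]
    [Module.Finite R N] :
    Subsingleton (Abelian.Ext (ModuleCat.of R E) (ModuleCat.of R (N →ₗ[R] E)) (i + 1)) ↔
      Subsingleton (Abelian.Ext (ModuleCat.of R N) (ModuleCat.of R R) (i + 1)) := by
  induction i generalizing N with
  | zero =>
    obtain ⟨n, f, hf⟩ := Module.Finite.exists_fin' R N
    have hS := LinearMap.shortExact_shortComplexKer hf
    have hS' := shortExact_dualComplexKer hE hf
    have := injective_dual_of_projective hE (Fin n → R)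
    have : Injective (dualComplexKer E f).X₂ :=
      Module.injective_object_of_injective_module R _
    have : Projective f.shortComplexKer.X₂ :=
      (IsProjective.iff_projective (Fin n → R)).1 inferInstance
    have h1 := subsingleton_ext_one_iff_of_injective hS' (ModuleCat.of R E)
    have h2 := subsingleton_ext_one_iff_of_projective hS (ModuleCat.of R R)
    refine h1.trans (Iff.trans ?_ h2.symm)
    have key := surjective_lcomp_dual_iff hE hc (LinearMap.ker f).subtype
    constructor
    · intro h g
      obtain ⟨φ, hφ⟩ := key.1 (fun φ => by
        obtain ⟨ψ, hψ⟩ := h (ModuleCat.ofHom φ)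
        exact ⟨ψ.hom, congrArg ModuleCat.Hom.hom hψ⟩) g.hom
      exact ⟨ModuleCat.ofHom φ, ModuleCat.hom_ext hφ⟩
    · intro h g
      obtain ⟨φ, hφ⟩ := key.2 (fun φ => by
        obtain ⟨ψ, hψ⟩ := h (ModuleCat.ofHom φ)
        exact ⟨ψ.hom, congrArg ModuleCat.Hom.hom hψ⟩) g.hom
      exact ⟨ModuleCat.ofHom φ, ModuleCat.hom_ext hφ⟩
  | succ i ih =>
    obtain ⟨n, f, hf⟩ := Module.Finite.exists_fin' R N
    have hS := LinearMap.shortExact_shortComplexKer hf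
    have hS' := shortExact_dualComplexKer hE hf
    have := injective_dual_of_projective hE (Fin n → R)
    have : Injective (dualComplexKer E f).X₂ :=
      Module.injective_object_of_injective_module R _
    have : Projective f.shortComplexKer.X₂ :=
      (IsProjective.iff_projective (Fin n → R)).1 inferInstance
    have h1 := subsingleton_ext_succ_iff_of_injective hS' (ModuleCat.of R E) i
    have h2 := subsingleton_ext_succ_iff_of_projective hS (ModuleCat.of R R) i
    exact h1.trans ((ih (LinearMap.ker f)).trans h2.symm)

variable [IsLocalRing R]

theorem isCogeneratorModule_of_residueField (hE : Module.Injective R E)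
    (ι : ResidueField R →ₗ[R] E) (hι : Function.Injective ι) : IsCogeneratorModule R E := by
  intro X _ _ x hx
  let I := LinearMap.ker (LinearMap.toSpanSingleton R X x)
  have hI : I ≤ LinearMap.ker (maximalIdeal R).mkQ := by
    rw [Submodule.ker_mkQ]
    refine le_maximalIdeal ((Ideal.ne_top_iff_one I).2 fun h1 => hx ?_)
    simpa [I] using h1
  obtain ⟨φ, hφ⟩ := hE.out (I.liftQ (LinearMap.toSpanSingleton R X x) le_rfl)
    (LinearMap.ker_eq_bot.1 (Submodule.ker_liftQ_eq_bot _ _ _ le_rfl))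
    (ι ∘ₗ I.liftQ (maximalIdeal R).mkQ hI)
  refine ⟨φ, fun h0 => one_ne_zero (α := ResidueField R) (hι ?_)⟩
  rw [map_zero, ← h0]
  have := hφ (Submodule.Quotient.mk 1)
  simp only [Submodule.liftQ_apply, LinearMap.toSpanSingleton_apply, one_smul] at this
  exact this.symm

/-- If `E` is an essential extension of the residue field `k`, then `k ≅ Hom(k, E)`. -/
theorem bijective_residueField_dual (ι : ResidueField R →ₗ[R] E) (hι : Function.Injective ι)
    (hess : ∀ N : Submodule R E, N ⊓ LinearMap.range ι = ⊥ → N = ⊥) :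
    Function.Bijective (LinearMap.compRight R ι ∘ₗ LinearMap.mul R (ResidueField R)) := by
  constructor
  · intro a b hab
    simpa using hι (LinearMap.congr_fun hab 1)
  · intro φ
    obtain ⟨c, hc⟩ : φ 1 ∈ LinearMap.range ι := by
      by_contra hn
      have hbot := hess (Submodule.span R {φ 1}) (by
        rw [Submodule.eq_bot_iff]
        rintro y ⟨hy, hyι⟩
        obtain ⟨r, rfl⟩ := Submodule.mem_span_singleton.1 hy
        by_cases hr : IsUnit r
        · exact absurd ((Submodule.smul_mem_iff_of_isUnit _ hr).1 hyι) hn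
        · rw [← map_smul, Algebra.smul_def, mul_one, ResidueField.algebraMap_eq,
            (residue_eq_zero_iff r).2 hr, map_zero])
      rw [Submodule.span_singleton_eq_bot] at hbot
      exact hn (hbot ▸ zero_mem _)
    refine ⟨c, LinearMap.ext fun x => ?_⟩
    obtain ⟨r, rfl⟩ := residue_surjective x
    have hr : residue R r = r • (1 : ResidueField R) := by
      rw [Algebra.smul_def, mul_one, ResidueField.algebraMap_eq]
    rw [hr, map_smul, map_smul, ← hc]
    simp

end InjectiveHull

/-- Let `R` be a commutative noetherian local ring with residue field `k`
and let `E` be an injective hull of `k` over `R` (an injective `R`-module containing `k` as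
an essential submodule).  Then `R` is Gorenstein (i.e. `R` has finite injective dimension as
an `R`-module) if and only if `Ext^i_R(E, k) = 0` for all sufficiently large `i`. -/
theorem gorenstein_iff_ext_injective_hull_vanishes
    (R : Type) [CommRing R] [IsNoetherianRing R] [IsLocalRing R]
    (E : Type) [AddCommGroup E] [Module R E] (hE : Module.Injective R E)
    (ι : IsLocalRing.ResidueField R →ₗ[R] E) (hι : Function.Injective ι)
    (hess : ∀ N : Submodule R E, N ⊓ LinearMap.range ι = ⊥ → N = ⊥) :
    HasFiniteInjDim R R ↔
      ∃ n : ℕ, ∀ i : ℕ, n ≤ i → Subsingleton (ExtGroup R i E (IsLocalRing.ResidueField R)) := by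
  have hc := isCogeneratorModule_of_residueField hE ι hι
  let e := LinearEquiv.ofBijective _ (bijective_residueField_dual ι hι hess)
  have key (i : ℕ) : Subsingleton (ExtGroup R (i + 1) E (IsLocalRing.ResidueField R)) ↔
      Subsingleton (CategoryTheory.Abelian.Ext (ModuleCat.of R (IsLocalRing.ResidueField R))
        (ModuleCat.of R R) (i + 1)) := by
    rw [← subsingleton_ext_dual_iff hE hc i, ← subsingleton_extGroup_succ_iff]
    exact (((Ext R (ModuleCat R) (i + 1)).obj (Opposite.op (ModuleCat.of R E))).mapIso
      e.toModuleIso).toLinearEquiv.toEquiv.subsingleton_congr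
  rw [hasFiniteInjDim_iff_ext_residueField]
  simp_rw [← key]
  constructor
  · rintro ⟨n, hn⟩
    refine ⟨n + 1, fun i hi => ?_⟩
    obtain ⟨j, rfl⟩ := Nat.exists_eq_add_of_le' (show 1 ≤ i by lia)
    exact hn j (by lia)
  · rintro ⟨n, hn⟩
    exact ⟨n, fun i hi => hn (i + 1) (by lia)⟩
end
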